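/- (One-dimensional sewing with Riemann sums.) Let V be a real Banach space, μ > 1, and g ∈ C_2(V) such that ||δg||_μ < ∞. Then there exists f ∈ C_1(V) with the following two properties: (i) for all 0 ≤ s ≤ t ≤ 1 and every sequence of partitions Π_n = {s = t_0^n < t_1^n < ... < t_{k_n}^n = t} of [s,t] whose mesh tends to 0, the Riemann sums Σ_{i=0}^{k_n - 1} g(t_i^n, t_{i+1}^n) converge in V to f(t) - f(s); (ii) ||(f(t) - f(s)) - g(s,t)|| ≤ (2^μ - 2)^{-1} ||δg||_μ |t - s|^μ for all s,t ∈ [0,1]. -/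

import Mathlib

open Set Filter
open scoped ENNReal Topology

noncomputable section


open Set
open scoped ENNReal

noncomputable section

def I01 : Set ℝ := Set.Icc 0 1

/-- Membership in `C_2(V)` (restricted to `[0,1]^2`). -/
def MemC2 (V : Type*) [NormedAddCommGroup V] (g : ℝ → ℝ → V) : Prop :=
  ContinuousOn (fun p : ℝ × ℝ => g p.1 p.2) (I01 ×ˢ I01) ∧ ∀ s ∈ I01, g s s = 0

/-- Membership in `C_3(V)` (restricted to `[0,1]^3`). -/
def MemC3 (V : Type*) [NormedAddCommGroup V] (h : ℝ → ℝ → ℝ → V) : Prop :=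
  ContinuousOn (fun p : ℝ × ℝ × ℝ => h p.1 p.2.1 p.2.2) (I01 ×ˢ I01 ×ˢ I01) ∧
    (∀ s ∈ I01, ∀ t ∈ I01, h s s t = 0) ∧ (∀ s ∈ I01, ∀ t ∈ I01, h s t t = 0)

/-- The coboundary `δ : C_2(V) → C_3(V)`, `(δ g)_{s u t} = g_{s t} - g_{s u} - g_{u t}`. -/
def delta2 (V : Type*) [NormedAddCommGroup V] (g : ℝ → ℝ → V) (s u t : ℝ) : V :=
  g s t - g s u - g u t

/-- The coboundary `δ : C_3(V) → C_4(V)`. -/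
def delta3 (V : Type*) [NormedAddCommGroup V] (h : ℝ → ℝ → ℝ → V) (t1 t2 t3 t4 : ℝ) : V :=
  h t2 t3 t4 - h t1 t3 t4 + h t1 t2 t4 - h t1 t2 t3

/-- The Hölder norm `‖g‖_μ` on `C_2(V)`. -/
noncomputable def norm2H (V : Type*) [NormedAddCommGroup V] (μ : ℝ) (g : ℝ → ℝ → V) : ℝ≥0∞ :=
  ⨆ (s : I01) (t : I01), ENNReal.ofReal (‖g (s : ℝ) (t : ℝ)‖ / |(t : ℝ) - (s : ℝ)| ^ μ)

/-- The Hölder norm `‖h‖_{γ,ρ}` on `C_3(V)`. -/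
noncomputable def norm3H (V : Type*) [NormedAddCommGroup V] (γ ρ : ℝ)
    (h : ℝ → ℝ → ℝ → V) : ℝ≥0∞ :=
  ⨆ (s : I01) (u : I01) (t : I01),
    ENNReal.ofReal (‖h (s : ℝ) (u : ℝ) (t : ℝ)‖ /
      (|(u : ℝ) - (s : ℝ)| ^ γ * |(t : ℝ) - (u : ℝ)| ^ ρ))

/-- The Hölder norm `‖h‖_μ` on `C_3(V)`, defined as an infimum over all finite
decompositions `h = ∑ h_i` with `h_i ∈ C_3(V)`. -/
noncomputable def norm3mu (V : Type*) [NormedAddCommGroup V] (μ : ℝ)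
    (h : ℝ → ℝ → ℝ → V) : ℝ≥0∞ :=
  ⨅ (n : ℕ) (hs : Fin n → (ℝ → ℝ → ℝ → V)) (ρs : Fin n → ℝ)
    (_ : (∀ i, 0 < ρs i ∧ ρs i < μ) ∧ (∀ i, MemC3 V (hs i)) ∧
      (∀ s ∈ I01, ∀ u ∈ I01, ∀ t ∈ I01, h s u t = ∑ i, hs i s u t)),
    ∑ i, norm3H V (ρs i) (μ - ρs i) (hs i)


/-- A sequence of partitions of `[a,b]` whose mesh tends to `0`. -/
def IsPartSeq (a b : ℝ) (m : ℕ → ℕ) (σ : ℕ → ℕ → ℝ) : Prop :=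
  (∀ n, σ n 0 = a) ∧ (∀ n, σ n (m n) = b) ∧
  (∀ n, ∀ i < m n, σ n i < σ n (i + 1)) ∧
  ∀ ε : ℝ, 0 < ε → ∃ N : ℕ, ∀ n ≥ N, ∀ i < m n, σ n (i + 1) - σ n i < ε

lemma sew_mid {s t : ℝ} (hs : s ∈ I01) (ht : t ∈ I01) : (s + t) / 2 ∈ I01 := by
  simp only [I01, Set.mem_Icc] at *
  constructor <;> linarith [hs.1, hs.2, ht.1, ht.2]

lemma sew_conv {s t θ : ℝ} (hs : s ∈ I01) (ht : t ∈ I01) (h0 : 0 ≤ θ) (h1 : θ ≤ 1) :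
    s + θ * (t - s) ∈ I01 := by
  simp only [I01, Set.mem_Icc] at *
  constructor <;> nlinarith [hs.1, hs.2, ht.1, ht.2]

lemma sew_term {V : Type*} [NormedAddCommGroup V] {μ ρ : ℝ} (h0 : 0 < ρ) (h1 : ρ < μ)
    {h : ℝ → ℝ → ℝ → V} (hh : MemC3 V h) {s u t R : ℝ} (hs : s ∈ I01) (hu : u ∈ I01)
    (ht : t ∈ I01) (hsu : |u - s| ≤ R) (hut : |t - u| ≤ R) :
    ENNReal.ofReal ‖h s u t‖ ≤ norm3H V ρ (μ - ρ) h * ENNReal.ofReal (R ^ μ) := by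
  by_cases e1 : s = u
  · subst e1
    simp [hh.2.1 s hs t ht]
  by_cases e2 : u = t
  · subst e2
    simp [hh.2.2 s hs u hu]
  have p1 : 0 < |u - s| := abs_pos.2 (sub_ne_zero.2 (Ne.symm e1))
  have p2 : 0 < |t - u| := abs_pos.2 (sub_ne_zero.2 (Ne.symm e2))
  have pR : 0 < R := lt_of_lt_of_le p1 hsu
  set w := |u - s| ^ ρ * |t - u| ^ (μ - ρ) with hw
  have pw : 0 < w := by positivity
  have hwR : w ≤ R ^ μ := by
    have : R ^ μ = R ^ ρ * R ^ (μ - ρ) := by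
      rw [← Real.rpow_add pR]; congr 1; ring
    rw [this, hw]
    have q : 0 ≤ μ - ρ := by linarith
    gcongr
  have e : ‖h s u t‖ = (‖h s u t‖ / w) * w := by field_simp
  rw [e, ENNReal.ofReal_mul (by positivity)]
  gcongr
  unfold norm3H
  exact le_iSup_of_le (⟨s, hs⟩ : I01) (le_iSup_of_le (⟨u, hu⟩ : I01)
    (le_iSup_of_le (⟨t, ht⟩ : I01) le_rfl))

lemma sew_delta {V : Type*} [NormedAddCommGroup V] {μ : ℝ} (hμ : 1 < μ) {g : ℝ → ℝ → V}
    (hmem : MemC2 V g) (hfin : norm3mu V μ (delta2 V g) ≠ ⊤)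
    {s u t R : ℝ} (hs : s ∈ I01) (hu : u ∈ I01)
    (ht : t ∈ I01) (hsu : |u - s| ≤ R) (hut : |t - u| ≤ R) :
    ‖g s t - g s u - g u t‖ ≤ (norm3mu V μ (delta2 V g)).toReal * R ^ μ := by
  have hR0 : 0 ≤ R := (abs_nonneg _).trans hsu
  rcases hR0.eq_or_lt with h0 | pR
  · subst h0
    have e1 : u = s := sub_eq_zero.1 (abs_nonpos_iff.1 hsu)
    have e2 : t = u := sub_eq_zero.1 (abs_nonpos_iff.1 hut)
    subst e2; subst e1
    rw [hmem.2 _ ht, Real.zero_rpow (by linarith)]; simp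
  have pRμ : 0 < R ^ μ := by positivity
  have key : ENNReal.ofReal ‖g s t - g s u - g u t‖ / ENNReal.ofReal (R ^ μ)
      ≤ norm3mu V μ (delta2 V g) := by
    unfold norm3mu
    refine le_iInf fun n => le_iInf fun hs' => le_iInf fun ρs => le_iInf fun H => ?_
    obtain ⟨H1, H2, H3⟩ := H
    apply ENNReal.div_le_of_le_mul
    have e : g s t - g s u - g u t = ∑ i, hs' i s u t := H3 s hs u hu t ht
    rw [e, Finset.sum_mul]
    calc ENNReal.ofReal ‖∑ i, hs' i s u t‖ ≤ ENNReal.ofReal (∑ i, ‖hs' i s u t‖) :=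
          ENNReal.ofReal_le_ofReal (norm_sum_le _ _)
      _ = ∑ i, ENNReal.ofReal ‖hs' i s u t‖ :=
          ENNReal.ofReal_sum_of_nonneg fun i _ => norm_nonneg _
      _ ≤ _ := Finset.sum_le_sum fun i _ => sew_term (H1 i).1 (H1 i).2 (H2 i) hs hu ht hsu hut
  have k2 := ENNReal.toReal_mono hfin key
  rw [ENNReal.toReal_div, ENNReal.toReal_ofReal (norm_nonneg _),
    ENNReal.toReal_ofReal pRμ.le, div_le_iff₀ pRμ] at k2
  exact k2

/-- dyadic refinements -/
def sewJ {V : Type*} [NormedAddCommGroup V] (g : ℝ → ℝ → V) : ℕ → ℝ → ℝ → V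
  | 0 => g
  | n + 1 => fun s t => sewJ g n s ((s + t) / 2) + sewJ g n ((s + t) / 2) t

lemma sewJ_cont {V : Type*} [NormedAddCommGroup V] {g : ℝ → ℝ → V}
    (hc : ContinuousOn (fun p : ℝ × ℝ => g p.1 p.2) (I01 ×ˢ I01)) (n : ℕ) :
    ContinuousOn (fun p : ℝ × ℝ => sewJ g n p.1 p.2) (I01 ×ˢ I01) := by
  induction n with
  | zero => exact hc
  | succ n ih =>
    refine ContinuousOn.add (f := fun p : ℝ × ℝ => sewJ g n p.1 ((p.1 + p.2) / 2))
      (g := fun p : ℝ × ℝ => sewJ g n ((p.1 + p.2) / 2) p.2) ?_ ?_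
    · refine ih.comp (f := fun p : ℝ × ℝ => (p.1, (p.1 + p.2) / 2))
        (Continuous.continuousOn (by fun_prop)) ?_
      exact fun p hp => ⟨hp.1, sew_mid hp.1 hp.2⟩
    · refine ih.comp (f := fun p : ℝ × ℝ => ((p.1 + p.2) / 2, p.2))
        (Continuous.continuousOn (by fun_prop)) ?_
      exact fun p hp => ⟨sew_mid hp.1 hp.2, hp.2⟩

lemma sew_half1 (s t : ℝ) : |(s + t) / 2 - s| = (1 / 2) * |t - s| := by
  rw [show (s + t) / 2 - s = (1 / 2) * (t - s) by ring, abs_mul]; norm_num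

lemma sew_half2 (s t : ℝ) : |t - (s + t) / 2| = (1 / 2) * |t - s| := by
  rw [show t - (s + t) / 2 = (1 / 2) * (t - s) by ring, abs_mul]; norm_num

lemma sewJ_step {V : Type*} [NormedAddCommGroup V] {g : ℝ → ℝ → V} {μ N : ℝ}
    (hδ : ∀ s ∈ I01, ∀ u ∈ I01, ∀ t ∈ I01, ∀ R, |u - s| ≤ R → |t - u| ≤ R →
      ‖g s t - g s u - g u t‖ ≤ N * R ^ μ) (n : ℕ) :
    ∀ s ∈ I01, ∀ t ∈ I01, ‖sewJ g n s t - sewJ g (n + 1) s t‖ ≤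
      (N * (1 / 2) ^ μ * |t - s| ^ μ) * (2 * (1 / 2) ^ μ) ^ n := by
  induction n with
  | zero =>
    intro s hs t ht
    have := hδ s hs _ (sew_mid hs ht) t ht _ (sew_half1 s t).le (sew_half2 s t).le
    rw [Real.mul_rpow (by norm_num) (abs_nonneg _)] at this
    simp only [sewJ, pow_zero, mul_one]
    rw [← sub_sub]
    linarith
  | succ n ih =>
    intro s hs t ht
    have hm := sew_mid hs ht
    have a1 := ih s hs _ hm
    have a2 := ih _ hm t ht
    rw [sew_half1, Real.mul_rpow (by norm_num) (abs_nonneg _)] at a1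
    rw [sew_half2, Real.mul_rpow (by norm_num) (abs_nonneg _)] at a2
    have e : sewJ g (n + 1) s t - sewJ g (n + 1 + 1) s t =
      (sewJ g n s ((s + t) / 2) - sewJ g (n + 1) s ((s + t) / 2)) +
      (sewJ g n ((s + t) / 2) t - sewJ g (n + 1) ((s + t) / 2) t) := by
      rw [show sewJ g (n + 1 + 1) s t = sewJ g (n + 1) s ((s + t) / 2)
        + sewJ g (n + 1) ((s + t) / 2) t from rfl,
        show sewJ g (n + 1) s t = sewJ g n s ((s + t) / 2)
        + sewJ g n ((s + t) / 2) t from rfl]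
      abel
    rw [e]
    refine (norm_add_le _ _).trans ((add_le_add a1 a2).trans (le_of_eq ?_))
    ring

lemma sew_ratio {μ : ℝ} (hμ : 1 < μ) : 2 * (1 / 2 : ℝ) ^ μ < 1 := by
  have := Real.rpow_lt_rpow_of_exponent_gt (x := 1 / 2) (by norm_num) (by norm_num) hμ
  rw [Real.rpow_one] at this
  linarith

lemma sew_exists {V : Type*} [NormedAddCommGroup V] [CompleteSpace V] {g : ℝ → ℝ → V} {μ N : ℝ}
    (hμ : 1 < μ) (hN : 0 ≤ N)
    (hc : ContinuousOn (fun p : ℝ × ℝ => g p.1 p.2) (I01 ×ˢ I01))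
    (hδ : ∀ s ∈ I01, ∀ u ∈ I01, ∀ t ∈ I01, ∀ R, |u - s| ≤ R → |t - u| ≤ R →
      ‖g s t - g s u - g u t‖ ≤ N * R ^ μ) :
    ∃ L : ℝ → ℝ → V, ContinuousOn (fun p : ℝ × ℝ => L p.1 p.2) (I01 ×ˢ I01) ∧
      (∀ s ∈ I01, ∀ t ∈ I01, L s t = L s ((s + t) / 2) + L ((s + t) / 2) t) ∧
      (∀ s ∈ I01, ∀ t ∈ I01, ‖L s t - g s t‖ ≤ ((2:ℝ) ^ μ - 2)⁻¹ * N * |t - s| ^ μ) := by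
  have hr := sew_ratio hμ
  set a : ℝ := (1 / 2 : ℝ) ^ μ with ha
  have pa : 0 < a := by positivity
  have hd : ∀ s ∈ I01, ∀ t ∈ I01, ∀ n, dist (sewJ g n s t) (sewJ g (n + 1) s t) ≤
      (N * a * |t - s| ^ μ) * (2 * a) ^ n := fun s hs t ht n => by
    rw [dist_eq_norm]; exact sewJ_step hδ n s hs t ht
  have hlim : ∀ s t, ∃ l, s ∈ I01 → t ∈ I01 →
      Tendsto (fun n => sewJ g n s t) atTop (𝓝 l) := by
    intro s t
    by_cases h : s ∈ I01 ∧ t ∈ I01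
    · obtain ⟨l, hl⟩ := cauchySeq_tendsto_of_complete
        (cauchySeq_of_le_geometric _ _ hr (hd s h.1 t h.2))
      exact ⟨l, fun _ _ => hl⟩
    · exact ⟨0, fun h1 h2 => (h ⟨h1, h2⟩).elim⟩
  choose L hL using hlim
  refine ⟨L, ?_, ?_, ?_⟩
  · have hu : TendstoUniformlyOn (fun n (p : ℝ × ℝ) => sewJ g n p.1 p.2)
        (fun p : ℝ × ℝ => L p.1 p.2) atTop (I01 ×ˢ I01) := by
      rw [Metric.tendstoUniformlyOn_iff]
      intro ε hε
      have ht0 : Tendsto (fun n : ℕ => (N * a) * (2 * a) ^ n / (1 - 2 * a)) atTop (𝓝 0) := by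
        have := ((tendsto_pow_atTop_nhds_zero_of_lt_one (by positivity) hr).const_mul
          (N * a)).div_const (1 - 2 * a)
        simpa using this
      filter_upwards [ht0.eventually_lt_const hε] with n hn p hp
      rw [dist_comm]
      refine lt_of_le_of_lt ?_ hn
      have := dist_le_of_le_geometric_of_tendsto _ _ hr (hd p.1 hp.1 p.2 hp.2)
        (hL _ _ hp.1 hp.2) n
      refine this.trans ?_
      have h1 : 0 < 1 - 2 * a := by linarith
      have h2 : |p.2 - p.1| ^ μ ≤ 1 := by
        apply Real.rpow_le_one (abs_nonneg _) _ (by linarith)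
        have q1 := hp.1
        have q2 := hp.2
        simp only [I01, Set.mem_Icc] at q1 q2
        rw [abs_le]; constructor <;> linarith [q1.1, q1.2, q2.1, q2.2]
      have h3 : N * a * |p.2 - p.1| ^ μ ≤ N * a := mul_le_of_le_one_right (by positivity) h2
      gcongr
    exact hu.continuousOn (Frequently.of_forall fun n => sewJ_cont hc n)
  · intro s hs t ht
    have hm := sew_mid hs ht
    have h1 := (hL s t hs ht).comp (tendsto_add_atTop_nat 1)
    have h2 := (hL _ _ hs hm).add (hL _ _ hm ht)
    exact tendsto_nhds_unique h1 h2
  · intro s hs t ht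
    have := dist_le_of_le_geometric_of_tendsto₀ _ _ hr (hd s hs t ht) (hL _ _ hs ht)
    rw [← dist_eq_norm, dist_comm]
    refine this.trans (le_of_eq ?_)
    have e : (2:ℝ) ^ μ = a⁻¹ := by
      rw [ha, ← Real.inv_rpow (by norm_num)]; norm_num
    rw [e]
    have h1 : 1 - 2 * a ≠ 0 := by linarith
    have h2 : a⁻¹ - 2 = (1 - 2 * a) / a := by field_simp
    rw [h2, inv_div]
    field_simp

lemma sew_unique {V : Type*} [NormedAddCommGroup V] {μ C : ℝ} (hμ : 1 < μ) {A : ℝ → ℝ → V}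
    (hA : ∀ s ∈ I01, ∀ t ∈ I01, A s t = A s ((s + t) / 2) + A ((s + t) / 2) t)
    (hb : ∀ s ∈ I01, ∀ t ∈ I01, ‖A s t‖ ≤ C * |t - s| ^ μ) :
    ∀ s ∈ I01, ∀ t ∈ I01, A s t = 0 := by
  have hn : ∀ n : ℕ, ∀ s ∈ I01, ∀ t ∈ I01,
      ‖A s t‖ ≤ (C * |t - s| ^ μ) * (2 * (1 / 2 : ℝ) ^ μ) ^ n := by
    intro n
    induction n with
    | zero => simpa using hb
    | succ n ih =>
      intro s hs t ht
      have hm := sew_mid hs ht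
      have a1 := ih s hs _ hm
      have a2 := ih _ hm t ht
      rw [sew_half1, Real.mul_rpow (by norm_num) (abs_nonneg _)] at a1
      rw [sew_half2, Real.mul_rpow (by norm_num) (abs_nonneg _)] at a2
      rw [hA s hs t ht]
      refine (norm_add_le _ _).trans ((add_le_add a1 a2).trans (le_of_eq ?_))
      ring
  intro s hs t ht
  have h0 := (tendsto_pow_atTop_nhds_zero_of_lt_one (by positivity) (sew_ratio hμ)).const_mul
    (C * |t - s| ^ μ)
  rw [mul_zero] at h0
  have := ge_of_tendsto' h0 (fun n => hn n s hs t ht)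
  exact norm_le_zero_iff.1 this

lemma sew_sum_double {V : Type*} [AddCommGroup V] (F : ℕ → V) (k : ℕ) :
    ∑ i ∈ Finset.range k, (F (2 * i) + F (2 * i + 1)) = ∑ i ∈ Finset.range (2 * k), F i := by
  induction k with
  | zero => simp
  | succ k ih =>
    rw [Finset.sum_range_succ, ih, show 2 * (k + 1) = 2 * k + 1 + 1 by ring,
      Finset.sum_range_succ, Finset.sum_range_succ, add_assoc]

lemma sew_arith_close {V : Type*} [NormedAddCommGroup V] {g L : ℝ → ℝ → V} {μ N K : ℝ}
    (hd : ∀ s ∈ I01, g s s = 0)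
    (hδ : ∀ s ∈ I01, ∀ u ∈ I01, ∀ t ∈ I01, ∀ R, |u - s| ≤ R → |t - u| ≤ R →
      ‖g s t - g s u - g u t‖ ≤ N * R ^ μ)
    (hL : ∀ s ∈ I01, ∀ t ∈ I01, ‖L s t - g s t‖ ≤ K * |t - s| ^ μ) (k : ℕ) :
    ∃ C, ∀ s ∈ I01, ∀ d : ℝ, s + k * d ∈ I01 →
      ‖∑ i ∈ Finset.range k, L (s + i * d) (s + (i + 1 : ℕ) * d) - g s (s + k * d)‖
        ≤ C * |d| ^ μ := by
  induction k with
  | zero =>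
    refine ⟨0, fun s hs d _ => ?_⟩
    simp [hd s hs]
  | succ k ih =>
    obtain ⟨C, hC⟩ := ih
    refine ⟨C + K + N * ((k + 1 : ℕ) : ℝ) ^ μ, fun s hs d hd' => ?_⟩
    have hk : s + k * d ∈ I01 := by
      have hp : (0:ℝ) < k + 1 := by positivity
      have := sew_conv (θ := k / (k + 1)) hs hd' (by positivity)
        ((div_le_one hp).2 (by linarith))
      convert this using 1
      push_cast; field_simp; ring
    have b1 := hC s hs d hk
    have b2 := hL _ hk _ hd'
    have b3 := hδ s hs _ hk _ hd' (((k + 1 : ℕ) : ℝ) * |d|) (by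
      rw [add_sub_cancel_left, abs_mul, Nat.abs_cast]; gcongr; simp) (by
      rw [show s + ((k + 1 : ℕ) : ℝ) * d - (s + k * d) = d by push_cast; ring]
      push_cast
      nlinarith [abs_nonneg d, (Nat.cast_nonneg k : (0:ℝ) ≤ k)])
    rw [Real.mul_rpow (by positivity) (abs_nonneg _)] at b3
    rw [show s + ((k + 1 : ℕ) : ℝ) * d - (s + k * d) = d by push_cast; ring] at b2
    rw [Finset.sum_range_succ]
    set S := ∑ i ∈ Finset.range k, L (s + i * d) (s + (i + 1 : ℕ) * d)
    set x := s + (k : ℝ) * d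
    set y := s + ((k + 1 : ℕ) : ℝ) * d
    have e : S + L x y - g s y = (S - g s x) + (L x y - g x y) - (g s y - g s x - g x y) := by
      abel
    rw [e]
    refine (norm_sub_le _ _).trans ?_
    have := norm_add_le (S - g s x) (L x y - g x y)
    nlinarith

lemma sew_arith {V : Type*} [NormedAddCommGroup V] {g L : ℝ → ℝ → V} {μ N K : ℝ} (hμ : 1 < μ)
    (hd : ∀ s ∈ I01, g s s = 0)
    (hδ : ∀ s ∈ I01, ∀ u ∈ I01, ∀ t ∈ I01, ∀ R, |u - s| ≤ R → |t - u| ≤ R →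
      ‖g s t - g s u - g u t‖ ≤ N * R ^ μ)
    (hm : ∀ s ∈ I01, ∀ t ∈ I01, L s t = L s ((s + t) / 2) + L ((s + t) / 2) t)
    (hL : ∀ s ∈ I01, ∀ t ∈ I01, ‖L s t - g s t‖ ≤ K * |t - s| ^ μ) (k : ℕ) (hk : 0 < k) :
    ∀ s ∈ I01, ∀ d : ℝ, s + k * d ∈ I01 →
      L s (s + k * d) = ∑ i ∈ Finset.range k, L (s + i * d) (s + (i + 1 : ℕ) * d) := by
  have hkR : (0:ℝ) < k := by exact_mod_cast hk
  obtain ⟨C, hC⟩ := sew_arith_close hd hδ hL k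
  let A : ℝ → ℝ → V := fun s t =>
    ∑ i ∈ Finset.range k, L (s + i * ((t - s) / k)) (s + (i + 1 : ℕ) * ((t - s) / k)) - L s t
  have hA0 : ∀ s ∈ I01, ∀ t ∈ I01, A s t = 0 := by
    refine sew_unique (C := C * (1 / k) ^ μ + K) hμ ?_ ?_
    · intro s hs t ht
      have hmm := sew_mid hs ht
      let F : ℕ → V := fun i =>
        L (s + i * ((t - s) / (2 * k))) (s + (i + 1 : ℕ) * ((t - s) / (2 * k)))
      have e1 : ∑ i ∈ Finset.range k,
          L (s + i * (((s + t) / 2 - s) / k)) (s + (i + 1 : ℕ) * (((s + t) / 2 - s) / k))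
          = ∑ i ∈ Finset.range k, F i := by
        refine Finset.sum_congr rfl fun i _ => ?_
        simp only [F]
        congr 1 <;> · field_simp; ring
      have e2 : ∑ i ∈ Finset.range k,
          L ((s + t) / 2 + i * ((t - (s + t) / 2) / k))
            ((s + t) / 2 + (i + 1 : ℕ) * ((t - (s + t) / 2) / k))
          = ∑ i ∈ Finset.range k, F (k + i) := by
        refine Finset.sum_congr rfl fun i _ => ?_
        simp only [F]
        congr 1 <;> · push_cast; field_simp; ring
      have e3 : ∑ i ∈ Finset.range k,
          L (s + i * ((t - s) / k)) (s + (i + 1 : ℕ) * ((t - s) / k))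
          = ∑ i ∈ Finset.range k, (F (2 * i) + F (2 * i + 1)) := by
        refine Finset.sum_congr rfl fun i hi => ?_
        have hik : i + 1 ≤ k := Finset.mem_range.1 hi
        have hik' : (i : ℝ) + 1 ≤ k := by exact_mod_cast hik
        have m1 : s + i * ((t - s) / k) ∈ I01 := by
          have := sew_conv (θ := i / k) hs ht (by positivity) ((div_le_one hkR).2 (by linarith))
          convert this using 1
          field_simp
        have m2 : s + (i + 1 : ℕ) * ((t - s) / k) ∈ I01 := by
          have := sew_conv (θ := (i + 1) / k) hs ht (by positivity)
            ((div_le_one hkR).2 (by linarith))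
          convert this using 1
          push_cast; field_simp
        rw [hm _ m1 _ m2]
        simp only [F]
        congr 2 <;> · push_cast; field_simp; try ring
      have e4 := sew_sum_double F k
      rw [two_mul, Finset.sum_range_add] at e4
      simp only [A]
      rw [e1, e2, e3, e4, hm s hs t ht]
      abel
    · intro s hs t ht
      have ee : s + k * ((t - s) / k) = t := by field_simp; ring
      have b1 := hC s hs ((t - s) / k) (by rw [ee]; exact ht)
      have b2 := hL s hs t ht
      rw [ee, show (t - s) / k = (1 / k) * (t - s) by ring, abs_mul,
        Real.mul_rpow (abs_nonneg _) (abs_nonneg _), abs_of_pos (by positivity : (0:ℝ) < 1 / k),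
        show (1 / k) * (t - s) = (t - s) / k by ring] at b1
      simp only [A]
      set S := ∑ i ∈ Finset.range k, L (s + i * ((t - s) / k)) (s + (i + 1 : ℕ) * ((t - s) / k))
      rw [show S - L s t = (S - g s t) - (L s t - g s t) by abel]
      refine (norm_sub_le _ _).trans ?_
      linarith
  intro s hs d hd'
  have := hA0 s hs _ hd'
  simp only [A, add_sub_cancel_left] at this
  rw [mul_div_cancel_left₀ d hkR.ne'] at this
  exact (sub_eq_zero.1 this).symm

lemma sew_add {V : Type*} [NormedAddCommGroup V] {g L : ℝ → ℝ → V} {μ N K : ℝ} (hμ : 1 < μ)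
    (hd : ∀ s ∈ I01, g s s = 0)
    (hδ : ∀ s ∈ I01, ∀ u ∈ I01, ∀ t ∈ I01, ∀ R, |u - s| ≤ R → |t - u| ≤ R →
      ‖g s t - g s u - g u t‖ ≤ N * R ^ μ)
    (hc : ContinuousOn (fun p : ℝ × ℝ => L p.1 p.2) (I01 ×ˢ I01))
    (hm : ∀ s ∈ I01, ∀ t ∈ I01, L s t = L s ((s + t) / 2) + L ((s + t) / 2) t)
    (hL : ∀ s ∈ I01, ∀ t ∈ I01, ‖L s t - g s t‖ ≤ K * |t - s| ^ μ) :
    ∀ s ∈ I01, ∀ u ∈ I01, ∀ t ∈ I01, s ≤ u → u ≤ t → L s t = L s u + L u t := by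
  have har := sew_arith hμ hd hδ hm hL
  intro s hs u hu t ht hsu hut
  rcases eq_or_lt_of_le (hsu.trans hut) with hst | hst
  · have e1 : u = s := le_antisymm (hst ▸ hut) hsu
    subst e1
    have : L u u = 0 := by
      have := hm u hu u hu
      rw [show (u + u) / 2 = u by ring] at this
      simpa using this
    rw [this, zero_add]
  -- interior rational points
  have hrat : ∀ q : ℚ, (0:ℝ) < q → (q:ℝ) < 1 →
      L s t = L s (s + q * (t - s)) + L (s + q * (t - s)) t := by
    intro q h0 h1
    have h0' : 0 < q := by exact_mod_cast h0
    have h1' : q < 1 := by exact_mod_cast h1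
    obtain ⟨p, hp⟩ : ∃ p : ℕ, q.num = p := ⟨q.num.toNat, by
      rw [Int.toNat_of_nonneg (Rat.num_nonneg.2 h0'.le)]⟩
    have hq : (q:ℝ) = p / q.den := by
      rw [Rat.cast_def, hp]; simp
    have hden : (0:ℝ) < q.den := by exact_mod_cast q.den_pos
    have hppos : 0 < p := by
      have := Rat.num_pos.2 h0'
      omega
    have hpden : p < q.den := by
      rw [hq, div_lt_one hden] at h1
      exact_mod_cast h1
    obtain ⟨r, hr⟩ := Nat.exists_eq_add_of_lt hpden
    set n := q.den
    set d := (t - s) / n with hdd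
    have et : s + n * d = t := by rw [hdd]; field_simp; ring
    have eu : s + q * (t - s) = s + p * d := by rw [hq, hdd]; field_simp
    have hum : s + q * (t - s) ∈ I01 := sew_conv hs ht h0.le h1.le
    have c1 := har n q.den_pos s hs d (by rw [et]; exact ht)
    have c2 := har p hppos s hs d (by rw [← eu]; exact hum)
    have et2 : (s + p * d) + (r + 1 : ℕ) * d = t := by
      rw [← et, hr]; push_cast; ring
    have c3 := har (r + 1) (by omega) (s + p * d) (by rw [← eu]; exact hum) d
      (by rw [et2]; exact ht)
    rw [et] at c1
    rw [et2] at c3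
    rw [eu, c1, c2, c3, hr, add_assoc, Finset.sum_range_add]
    congr 1
    refine Finset.sum_congr rfl fun i _ => ?_
    congr 1 <;> · push_cast; ring
  let φ : ℝ → V := fun θ => L s (s + θ * (t - s)) + L (s + θ * (t - s)) t
  have hφ : ContinuousOn φ (Set.Icc 0 1) := by
    refine ContinuousOn.add ?_ ?_
    · exact hc.comp (f := fun θ : ℝ => (s, s + θ * (t - s)))
        (Continuous.continuousOn (by fun_prop)) fun θ h => ⟨hs, sew_conv hs ht h.1 h.2⟩
    · exact hc.comp (f := fun θ : ℝ => (s + θ * (t - s), t))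
        (Continuous.continuousOn (by fun_prop)) fun θ h => ⟨sew_conv hs ht h.1 h.2, ht⟩
  set T : Set ℝ := Set.Ioo 0 1 ∩ Set.range ((↑) : ℚ → ℝ) with hT
  have hcl : Set.Icc (0:ℝ) 1 ⊆ closure T := by
    have h : Dense (Set.range ((↑) : ℚ → ℝ)) := Rat.denseRange_cast (𝕜 := ℝ)
    rw [← closure_Ioo (zero_ne_one (α := ℝ))]
    exact closure_minimal (h.open_subset_closure_inter isOpen_Ioo) isClosed_closure
  have hall : Set.EqOn φ (fun _ => L s t) (Set.Icc 0 1) := by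
    refine Set.EqOn.of_subset_closure (s := T) ?_ hφ continuousOn_const ?_ hcl
    · rintro _ ⟨⟨a, b⟩, q, rfl⟩
      exact (hrat q a b).symm
    · exact fun x hx => ⟨hx.1.1.le, hx.1.2.le⟩
  have pts : 0 < t - s := by linarith
  have := hall (x := (u - s) / (t - s))
    ⟨div_nonneg (by linarith) pts.le, (div_le_one pts).2 (by linarith)⟩
  simp only [φ] at this
  rw [div_mul_cancel₀ _ pts.ne', add_sub_cancel] at this
  exact this.symm

lemma sew_antisymm {V : Type*} [NormedAddCommGroup V] {g L : ℝ → ℝ → V} {μ N K : ℝ}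
    (hμ : 1 < μ) (hd : ∀ s ∈ I01, g s s = 0)
    (hδ : ∀ s ∈ I01, ∀ u ∈ I01, ∀ t ∈ I01, ∀ R, |u - s| ≤ R → |t - u| ≤ R →
      ‖g s t - g s u - g u t‖ ≤ N * R ^ μ)
    (hm : ∀ s ∈ I01, ∀ t ∈ I01, L s t = L s ((s + t) / 2) + L ((s + t) / 2) t)
    (hL : ∀ s ∈ I01, ∀ t ∈ I01, ‖L s t - g s t‖ ≤ K * |t - s| ^ μ) :
    ∀ s ∈ I01, ∀ t ∈ I01, L s t + L t s = 0 := by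
  refine sew_unique (A := fun s t => L s t + L t s) (C := K + K + N) hμ ?_ ?_
  · intro s hs t ht
    rw [hm s hs t ht, hm t ht s hs, add_comm t s]
    abel
  · intro s hs t ht
    have b1 := hL s hs t ht
    have b2 := hL t ht s hs
    have b3 := hδ s hs t ht s hs |t - s| le_rfl (abs_sub_comm s t).le
    rw [abs_sub_comm] at b2
    rw [hd s hs] at b3
    rw [show L s t + L t s = (L s t - g s t) + (L t s - g t s) - (0 - g s t - g t s) by abel]
    refine (norm_sub_le _ _).trans ?_
    have := norm_add_le (L s t - g s t) (L t s - g t s)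
    linarith

lemma sew_riemann {V : Type*} [NormedAddCommGroup V] {g : ℝ → ℝ → V} {f : ℝ → V} {μ K : ℝ}
    (hμ : 1 < μ) (hK : 0 ≤ K)
    (hf : ∀ s ∈ I01, ∀ t ∈ I01, ‖(f t - f s) - g s t‖ ≤ K * |t - s| ^ μ)
    {s t : ℝ} (hs : s ∈ I01) (ht : t ∈ I01) {m : ℕ → ℕ} {σ : ℕ → ℕ → ℝ}
    (hσ : IsPartSeq s t m σ) :
    Tendsto (fun n => ∑ i ∈ Finset.range (m n), g (σ n i) (σ n (i + 1)))
      atTop (𝓝 (f t - f s)) := by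
  obtain ⟨h0, h1, hmono, hmesh⟩ := hσ
  rw [Metric.tendsto_atTop]
  intro η hη
  have hpos : 0 < η / (K + 1) := by positivity
  set ε := (η / (K + 1)) ^ (1 / (μ - 1)) with hε
  have pε : 0 < ε := by positivity
  have eε : ε ^ (μ - 1) = η / (K + 1) := by
    rw [hε, ← Real.rpow_mul hpos.le, one_div_mul_cancel (by linarith), Real.rpow_one]
  obtain ⟨M, hM⟩ := hmesh ε pε
  refine ⟨M, fun n hn => ?_⟩
  have hle : ∀ i j, i ≤ j → j ≤ m n → σ n i ≤ σ n j := by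
    intro i j hij
    induction j, hij using Nat.le_induction with
    | base => exact fun _ => le_rfl
    | succ j _ ih => exact fun hj => (ih (by omega)).trans (hmono n j (by omega)).le
  have hI : ∀ i, i ≤ m n → σ n i ∈ I01 := by
    intro i hi
    have a := hle 0 i (by omega) hi
    have b := hle i (m n) hi le_rfl
    rw [h0] at a
    rw [h1] at b
    exact ⟨hs.1.trans a, b.trans ht.2⟩
  have etel : f t - f s = ∑ i ∈ Finset.range (m n), (f (σ n (i + 1)) - f (σ n i)) := by
    rw [Finset.sum_range_sub (fun i => f (σ n i)), h0, h1]
  rw [dist_comm, dist_eq_norm, etel, ← Finset.sum_sub_distrib]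
  have hterm : ∀ i ∈ Finset.range (m n),
      ‖f (σ n (i + 1)) - f (σ n i) - g (σ n i) (σ n (i + 1))‖ ≤
        K * (η / (K + 1)) * (σ n (i + 1) - σ n i) := by
    intro i hi
    have hi := Finset.mem_range.1 hi
    have hp : 0 < σ n (i + 1) - σ n i := sub_pos.2 (hmono n i hi)
    refine (hf _ (hI i hi.le) _ (hI (i + 1) hi)).trans ?_
    rw [abs_of_pos hp, mul_assoc]
    gcongr
    calc (σ n (i + 1) - σ n i) ^ μ
        = (σ n (i + 1) - σ n i) ^ (μ - 1) * (σ n (i + 1) - σ n i) := by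
          rw [← Real.rpow_add_one hp.ne', sub_add_cancel]
      _ ≤ ε ^ (μ - 1) * (σ n (i + 1) - σ n i) := by
          have := (hM n hn i hi).le
          have q : 0 ≤ μ - 1 := by linarith
          gcongr
      _ = _ := by rw [eε]
  refine lt_of_le_of_lt (norm_sum_le_of_le _ hterm) ?_
  rw [← Finset.mul_sum, Finset.sum_range_sub (fun i => σ n i), h0, h1]
  have hts : t - s ≤ 1 := by linarith [ht.2, hs.1]
  have hc : K * (η / (K + 1)) < η := by
    rw [← mul_div_assoc, div_lt_iff₀ (by positivity)]
    nlinarith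
  have : K * (η / (K + 1)) * (t - s) ≤ K * (η / (K + 1)) :=
    mul_le_of_le_one_right (by positivity) hts
  linarith

/-- One-dimensional sewing with Riemann sums. -/
theorem one_dimensional_sewing_riemann_sums
    (V : Type*) [NormedAddCommGroup V] [NormedSpace ℝ V] [CompleteSpace V]
    (μ : ℝ) (hμ : 1 < μ) (g : ℝ → ℝ → V) (hmem : MemC2 V g)
    (hfin : norm3mu V μ (delta2 V g) ≠ ⊤) :
    ∃ f : ℝ → V, ContinuousOn f I01 ∧
      (∀ s ∈ I01, ∀ t ∈ I01, s ≤ t →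
        ∀ (m : ℕ → ℕ) (σ : ℕ → ℕ → ℝ), IsPartSeq s t m σ →
          Tendsto (fun n => ∑ i ∈ Finset.range (m n), g (σ n i) (σ n (i + 1)))
            atTop (𝓝 (f t - f s))) ∧
      (∀ s ∈ I01, ∀ t ∈ I01,
        ‖(f t - f s) - g s t‖ ≤
          ((2:ℝ) ^ μ - 2)⁻¹ * (norm3mu V μ (delta2 V g)).toReal * |t - s| ^ μ) := by
  set N := (norm3mu V μ (delta2 V g)).toReal with hNdef
  have hN : 0 ≤ N := ENNReal.toReal_nonneg
  have hδ : ∀ s ∈ I01, ∀ u ∈ I01, ∀ t ∈ I01, ∀ R, |u - s| ≤ R → |t - u| ≤ R →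
      ‖g s t - g s u - g u t‖ ≤ N * R ^ μ := fun s hs u hu t ht R h1 h2 =>
    sew_delta hμ hmem hfin hs hu ht h1 h2
  obtain ⟨L, hLc, hLm, hLb⟩ := sew_exists hμ hN hmem.1 hδ
  have hadd := sew_add hμ hmem.2 hδ hLc hLm hLb
  have hanti := sew_antisymm hμ hmem.2 hδ hLm hLb
  have z : (0:ℝ) ∈ I01 := ⟨le_rfl, zero_le_one⟩
  have hfL : ∀ s ∈ I01, ∀ t ∈ I01, L 0 t - L 0 s = L s t := by
    intro s hs t ht
    rcases le_total s t with h | h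
    · rw [hadd 0 z s hs t ht hs.1 h]; abel
    · rw [hadd 0 z t ht s hs ht.1 h, eq_neg_of_add_eq_zero_left (hanti s hs t ht)]; abel
  have hb : ∀ s ∈ I01, ∀ t ∈ I01, ‖(L 0 t - L 0 s) - g s t‖ ≤
      ((2:ℝ) ^ μ - 2)⁻¹ * N * |t - s| ^ μ := fun s hs t ht => by
    rw [hfL s hs t ht]; exact hLb s hs t ht
  have h2 : (2:ℝ) < 2 ^ μ := by
    have := Real.rpow_lt_rpow_of_exponent_lt (x := 2) (by norm_num) hμ
    rwa [Real.rpow_one] at this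
  have hK : 0 ≤ ((2:ℝ) ^ μ - 2)⁻¹ * N := mul_nonneg (inv_nonneg.2 (by linarith)) hN
  refine ⟨fun t => L 0 t, ?_, ?_, hb⟩
  · exact hLc.comp (f := fun t : ℝ => ((0:ℝ), t))
      (Continuous.continuousOn (by fun_prop)) fun t ht => ⟨z, ht⟩
  · intro s hs t ht _ m σ hσ
    exact sew_riemann (f := fun t => L 0 t) hμ hK hb hs ht hσ
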